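/- Let X be a real Hilbert space, φ : X → ℝ convex and continuous, {C_i}_{i=1}^m nonempty, closed and convex subsets of X with nonempty intersection C, and let D ⊆ C be a nonempty subset of C. Suppose a sequence {y^k}_{k=0}^∞ generated by the superiorized DSAP algorithm with positive step-sizes {{β_{k,n}}_{n=0}^{N_k−1}}_{k=0}^∞ and initialization y^0 ∈ X converges in norm to a point y* ∈ D, and suppose there exists a point ĉ ∈ C such that d(ĉ, D) > Σ_{k=0}^∞ Σ_{n=0}^{N_k−1} β_{k,n}. Then ‖y^0 − ĉ‖ ≥ ( d(ĉ, D)·(Σ_{k=0}^∞ Σ_{n=0}^{N_k−1} β_{k,n})^{−1} − 1 )·Σ_{n=0}^{N_0−1} β_{0,n}. -/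

import Mathlib

open scoped RealInnerProductSpace

/-- The string operator `P[t] := P_{t_q} ∘ ⋯ ∘ P_{t_1}` : the composition of the
projections indexed by the entries of the index vector `t`, applied in order. -/
def stringOp {X : Type*} {m : ℕ} (P : Fin m → X → X) (t : List (Fin m)) (x : X) : X :=
  t.foldl (fun y i => P i y) x

/-- The string-averaging operator `P_{Ω,w}(x) := Σ_{t ∈ Ω} w(t) • P[t](x)`. -/
noncomputable def strAvg {X : Type*} [NormedAddCommGroup X] [InnerProductSpace ℝ X] {m : ℕ}
    (P : Fin m → X → X) (Ω : Finset (List (Fin m))) (w : List (Fin m) → ℝ) (x : X) : X :=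
  ∑ t ∈ Ω, w t • stringOp P t x

/-- The subgradient set `∂φ(z)` of a function `φ` at a point `z`. -/
def subdiff {X : Type*} [NormedAddCommGroup X] [InnerProductSpace ℝ X]
    (φ : X → ℝ) (z : X) : Set X :=
  {s : X | ∀ y : X, φ z + ⟪s, y - z⟫ ≤ φ y}

theorem aux_proj {X : Type*} [NormedAddCommGroup X] [InnerProductSpace ℝ X]
    (K : Set X) (hK : Convex ℝ K) (x p : X) (hp : p ∈ K) (hmin : ∀ c ∈ K, ‖x - p‖ ≤ ‖x - c‖)
    (c : X) (hc : c ∈ K) : ‖p - c‖ ≤ ‖x - c‖ := by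
  have hinf : ‖x - p‖ = ⨅ w : K, ‖x - w‖ := by
    haveI : Nonempty K := ⟨⟨p, hp⟩⟩
    apply le_antisymm
    · exact le_ciInf fun w => hmin w w.2
    · exact ciInf_le (f := fun w : K => ‖x - w‖)
        ⟨0, by rintro _ ⟨w, rfl⟩; exact norm_nonneg _⟩ ⟨p, hp⟩
  have h := (norm_eq_iInf_iff_real_inner_le_zero hK hp).1 hinf c hc
  have e : x - c = (x - p) - (c - p) := by abel
  have h2 := norm_sub_sq_real (x - p) (c - p)
  rw [← e] at h2
  have h3 : ‖p - c‖ = ‖c - p‖ := norm_sub_rev _ _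
  rw [h3]
  apply le_of_sq_le_sq _ (norm_nonneg _)
  nlinarith [sq_nonneg ‖x - p‖]

theorem aux_string {X : Type*} [NormedAddCommGroup X] {m : ℕ}
    (P : Fin m → X → X) (c : X) (h : ∀ i x, ‖P i x - c‖ ≤ ‖x - c‖) (t : List (Fin m)) :
    ∀ x, ‖stringOp P t x - c‖ ≤ ‖x - c‖ := by
  induction t with
  | nil => intro x; exact le_rfl
  | cons a t ih => intro x; exact (ih (P a x)).trans (h a x)

theorem aux_avg {X : Type*} [NormedAddCommGroup X] [InnerProductSpace ℝ X] {m : ℕ}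
    (P : Fin m → X → X) (c : X) (h : ∀ i x, ‖P i x - c‖ ≤ ‖x - c‖)
    (Ω : Finset (List (Fin m))) (w : List (Fin m) → ℝ) (hw : ∀ t ∈ Ω, 0 < w t)
    (hs : ∑ t ∈ Ω, w t = 1) (x : X) : ‖strAvg P Ω w x - c‖ ≤ ‖x - c‖ := by
  have e : strAvg P Ω w x - c = ∑ t ∈ Ω, w t • (stringOp P t x - c) := by
    simp only [smul_sub, Finset.sum_sub_distrib, ← Finset.sum_smul, hs, one_smul, strAvg]
  rw [e]
  calc _ ≤ ∑ t ∈ Ω, ‖w t • (stringOp P t x - c)‖ := norm_sum_le _ _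
    _ ≤ ∑ t ∈ Ω, w t * ‖x - c‖ := by
        apply Finset.sum_le_sum
        intro t ht
        rw [norm_smul, Real.norm_of_nonneg (hw t ht).le]
        exact mul_le_mul_of_nonneg_left (aux_string P c h t x) (hw t ht).le
    _ = ‖x - c‖ := by rw [← Finset.sum_mul, hs, one_mul]

theorem stmt_6
    {X : Type*} [NormedAddCommGroup X] [InnerProductSpace ℝ X] [CompleteSpace X]
    -- a convex continuous objective function
    (φ : X → ℝ) (hφconv : ConvexOn ℝ Set.univ φ) (hφcont : Continuous φ)
    {m : ℕ} (C : Fin m → Set X)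
    (hCne : ∀ i, (C i).Nonempty) (hCcl : ∀ i, IsClosed (C i)) (hCcv : ∀ i, Convex ℝ (C i))
    (hCint : (⋂ i, C i).Nonempty)
    -- a nonempty subset D of C
    (D : Set X) (hD : D ⊆ ⋂ i, C i) (hDne : D.Nonempty)
    -- `P i` is the metric projection onto `C i`
    (P : Fin m → X → X)
    (hP : ∀ i x, P i x ∈ C i ∧ ∀ c ∈ C i, ‖x - P i x‖ ≤ ‖x - c‖)
    -- (Ω_k, w_k) : finite fit sets of index vectors with positive weights summing to 1
    (Ω : ℕ → Finset (List (Fin m))) (w : ℕ → List (Fin m) → ℝ)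
    (hΩne : ∀ k, ∀ t ∈ Ω k, t ≠ [])
    (hfit : ∀ k, ∀ i : Fin m, ∃ t ∈ Ω k, i ∈ t)
    (hwpos : ∀ k, ∀ t ∈ Ω k, 0 < w k t)
    (hwsum : ∀ k, ∑ t ∈ Ω k, w k t = 1)
    -- the superiorized version of the DSAP algorithm
    (N : ℕ) (Nk : ℕ → ℕ) (hNk : ∀ k, 1 ≤ Nk k ∧ Nk k ≤ N)
    (β : ℕ → ℕ → ℝ) (hβ : ∀ k, ∀ n < Nk k, 0 < β k n ∧ β k n ≤ 1)
    (hβsum : Summable fun k => ∑ n ∈ Finset.range (Nk k), β k n)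
    (y : ℕ → X) (Y : ℕ → ℕ → X) (v : ℕ → ℕ → X) (s : ℕ → ℕ → X)
    (hY0 : ∀ k, Y k 0 = y k)
    (hs : ∀ k, ∀ n < Nk k, s k n ∈ subdiff φ (Y k n))
    (hv : ∀ k, ∀ n < Nk k,
      ((0 : X) ∉ subdiff φ (Y k n) → v k n = -(‖s k n‖⁻¹ • s k n)) ∧
      ((0 : X) ∈ subdiff φ (Y k n) → v k n = 0))
    (hYn : ∀ k, ∀ n < Nk k, Y k (n + 1) = Y k n + β k n • v k n)
    (hy : ∀ k, y (k + 1) = strAvg P (Ω k) (w k) (Y k (Nk k)))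
    -- the sequence converges in norm to a point y* ∈ D
    (ystar : X) (hconv : Filter.Tendsto y Filter.atTop (nhds ystar)) (hyD : ystar ∈ D)
    -- a point ĉ ∈ C far enough from D
    (chat : X) (hchat : chat ∈ ⋂ i, C i)
    (hfar : Metric.infDist chat D > ∑' k : ℕ, ∑ n ∈ Finset.range (Nk k), β k n) :
    ‖y 0 - chat‖ ≥
      (Metric.infDist chat D * (∑' k : ℕ, ∑ n ∈ Finset.range (Nk k), β k n)⁻¹ - 1) *
        ∑ n ∈ Finset.range (Nk 0), β 0 n := by
  have hpr : ∀ i x, ‖P i x - chat‖ ≤ ‖x - chat‖ := fun i x =>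
    aux_proj (C i) (hCcv i) x _ (hP i x).1 (hP i x).2 chat (Set.mem_iInter.1 hchat i)
  have hvn : ∀ k, ∀ n < Nk k, ‖v k n‖ ≤ 1 := by
    intro k n hn
    by_cases h0 : (0 : X) ∈ subdiff φ (Y k n)
    · rw [(hv k n hn).2 h0]; simp
    · rw [(hv k n hn).1 h0, norm_neg, norm_smul, norm_inv, norm_norm]
      exact inv_mul_le_one
  have hin : ∀ k, ∀ n ≤ Nk k,
      ‖Y k n - chat‖ ≤ ‖y k - chat‖ + ∑ j ∈ Finset.range n, β k j := by
    intro k n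
    induction n with
    | zero => intro _; simp [hY0]
    | succ n ih =>
      intro hn
      have hn' : n < Nk k := hn
      rw [hYn k n hn', Finset.sum_range_succ]
      have h1 := ih hn'.le
      have h2 : ‖β k n • v k n‖ ≤ β k n := by
        rw [norm_smul, Real.norm_of_nonneg (hβ k n hn').1.le]
        exact mul_le_of_le_one_right (hβ k n hn').1.le (hvn k n hn')
      have h3 : Y k n + β k n • v k n - chat = (Y k n - chat) + β k n • v k n := by abel
      rw [h3]
      linarith [norm_add_le (Y k n - chat) (β k n • v k n)]
  have hb : ∀ k, 0 < ∑ n ∈ Finset.range (Nk k), β k n := by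
    intro k
    apply Finset.sum_pos
    · intro n hn; exact (hβ k n (Finset.mem_range.1 hn)).1
    · exact Finset.nonempty_range_iff.2 (by have := (hNk k).1; omega)
  have hout : ∀ k, ‖y k - chat‖ ≤ ‖y 0 - chat‖ +
      ∑ j ∈ Finset.range k, ∑ n ∈ Finset.range (Nk j), β j n := by
    intro k
    induction k with
    | zero => simp
    | succ k ih =>
      rw [hy k, Finset.sum_range_succ]
      have := aux_avg P chat hpr (Ω k) (w k) (hwpos k) (hwsum k) (Y k (Nk k))
      linarith [hin k (Nk k) le_rfl]
  have hlim : ‖ystar - chat‖ ≤ ‖y 0 - chat‖ +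
      ∑' k : ℕ, ∑ n ∈ Finset.range (Nk k), β k n := by
    refine le_of_tendsto (hconv.sub_const chat).norm (Filter.Eventually.of_forall fun k => ?_)
    have := hβsum.sum_le_tsum (Finset.range k) (fun j _ => (hb j).le)
    linarith [hout k]
  have hd : Metric.infDist chat D ≤ ‖ystar - chat‖ := by
    rw [← dist_eq_norm, dist_comm]
    exact Metric.infDist_le_dist_of_mem hyD
  have h0B := hβsum.le_tsum 0 (fun j _ => (hb j).le)
  have hb0 := hb 0
  generalize (∑' k : ℕ, ∑ n ∈ Finset.range (Nk k), β k n) = B at *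
  generalize (∑ n ∈ Finset.range (Nk 0), β 0 n) = b at *
  have hB : 0 < B := lt_of_lt_of_le hb0 h0B
  have h1 : 0 ≤ Metric.infDist chat D * B⁻¹ - 1 := by
    rw [sub_nonneg, ← div_eq_mul_inv, one_le_div hB]; exact hfar.le
  have h2 := mul_le_mul_of_nonneg_left h0B h1
  have h3 : (Metric.infDist chat D * B⁻¹ - 1) * B = Metric.infDist chat D - B := by
    field_simp
  linarith
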